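/- arXiv:2505.10184 — 2 statements merged into one kernel-verified Lean document; each statement's English description precedes it below -/
import Mathlib

section
/- Let F be a field, x ∈ F^n a vector with pairwise distinct entries, y ∈ F^n a vector with all entries nonzero, and r ≥ 1 an integer. Then GRS_r(x,y) ⋆ GRS_r(x,y) = GRS_{2r−1}(x, y⋆y). -/
/-- The generalized Reed–Solomon code `GRS_r(x, y)`:
evaluations of polynomials of degree `< r` at the support `x`, scaled by the multiplier `y`. -/
noncomputable def GRS {F : Type*} [Field F] {n : ℕ} (r : ℕ) (x y : Fin n → F) :
    Submodule F (Fin n → F) :=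
  Submodule.map (LinearMap.pi fun i => y i • Polynomial.leval (x i))
    (Polynomial.degreeLT F r)

/-- Componentwise (star) product of two linear codes. -/
def starProd {F : Type*} [Field F] {n : ℕ} (C D : Submodule F (Fin n → F)) :
    Submodule F (Fin n → F) :=
  Submodule.span F { w | ∃ c ∈ C, ∃ d ∈ D, w = c * d }

theorem mem_GRS_iff {F : Type*} [Field F] {n : ℕ} {r : ℕ} {x y w : Fin n → F} :
    w ∈ GRS r x y ↔ ∃ p : Polynomial F, p.degree < r ∧ w = fun i => y i * p.eval (x i) := by
  simp only [GRS, Submodule.mem_map, Polynomial.mem_degreeLT]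
  refine exists_congr fun p => and_congr_right fun _ => ?_
  rw [eq_comm]
  rfl

theorem starProd_GRS_le {F : Type*} [Field F] {n : ℕ} (r s : ℕ) (x y z : Fin n → F) :
    starProd (GRS r x y) (GRS s x z) ≤ GRS (r + s - 1) x (y * z) := by
  refine Submodule.span_le.2 ?_
  rintro _ ⟨_, hc, _, hd, rfl⟩
  obtain ⟨p, hp, rfl⟩ := mem_GRS_iff.1 hc
  obtain ⟨q, hq, rfl⟩ := mem_GRS_iff.1 hd
  refine mem_GRS_iff.2 ⟨p * q, ?_, ?_⟩
  · rcases eq_or_ne p 0 with rfl | hp0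
    · simp [bot_lt_iff_ne_bot]
    rcases eq_or_ne q 0 with rfl | hq0
    · simp [bot_lt_iff_ne_bot]
    rw [← Polynomial.natDegree_lt_iff_degree_lt hp0] at hp
    rw [← Polynomial.natDegree_lt_iff_degree_lt hq0] at hq
    rw [← Polynomial.natDegree_lt_iff_degree_lt (mul_ne_zero hp0 hq0),
      Polynomial.natDegree_mul hp0 hq0]
    omega
  · funext i
    simp only [Pi.mul_apply, Polynomial.eval_mul]
    ring

theorem GRS_le_starProd {F : Type*} [Field F] {n : ℕ} {r s : ℕ} (hr : 1 ≤ r) (hs : 1 ≤ s)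
    (x y z : Fin n → F) :
    GRS (r + s - 1) x (y * z) ≤ starProd (GRS r x y) (GRS s x z) := by
  classical
  rw [GRS, Polynomial.degreeLT_eq_span_X_pow, Submodule.map_span_le]
  intro p hp
  simp only [Finset.coe_image, Finset.coe_range, Set.mem_image, Set.mem_Iio] at hp
  obtain ⟨k, hk, rfl⟩ := hp
  refine Submodule.subset_span
    ⟨fun i => y i * (Polynomial.X ^ min k (r - 1) : Polynomial F).eval (x i),
      mem_GRS_iff.2 ⟨_, ?_, rfl⟩,
      fun i => z i * (Polynomial.X ^ (k - min k (r - 1)) : Polynomial F).eval (x i),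
      mem_GRS_iff.2 ⟨_, ?_, rfl⟩, ?_⟩
  · rw [Polynomial.degree_X_pow]
    exact_mod_cast (by omega : min k (r - 1) < r)
  · rw [Polynomial.degree_X_pow]
    exact_mod_cast (by omega : k - min k (r - 1) < s)
  · funext i
    have hpow : x i ^ k = x i ^ min k (r - 1) * x i ^ (k - min k (r - 1)) := by
      rw [← pow_add, Nat.add_sub_cancel' (min_le_left _ _)]
    simp only [LinearMap.pi_apply, LinearMap.smul_apply, Polynomial.leval_apply, smul_eq_mul,
      Pi.mul_apply, Polynomial.eval_pow, Polynomial.eval_X, hpow]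
    ring

theorem stmt2 {F : Type*} [Field F] {n : ℕ} (r : ℕ) (x y : Fin n → F)
    (hx : Function.Injective x) (hy : ∀ i, y i ≠ 0) (hr : 1 ≤ r) :
    starProd (GRS r x y) (GRS r x y) = GRS (2 * r - 1) x (y * y) := by
  rw [two_mul]
  exact le_antisymm (starProd_GRS_le r r x y y) (GRS_le_starProd hr hr x y y)
end

section
/- Let F be a field, x ∈ F^n with pairwise distinct entries, y ∈ F^n with all entries nonzero, and let r ≥ 2 be an integer with 2r−1 ≤ n. Let V_r(x,y) ∈ F^{r×n} be the matrix with entry x_j^i·y_j in row i (0 ≤ i ≤ r−1) and column j (1 ≤ j ≤ n). Then the F-vector space I_2(V_r(x,y)) is spanned by the 2×2 minors X_i·X_{j+1} − X_{i+1}·X_j (for 0 ≤ i < j ≤ r−2) of the 2×(r−1) matrix whose first row is (X_0,…,X_{r−2}) and second row is (X_1,…,X_{r−1}). -/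
open MvPolynomial

/-- `I₂(G)`: the `F`-vector space of homogeneous quadratic polynomials vanishing at
all the columns of the matrix `G`. -/
noncomputable def I2 {σ : Type*} {L : Type*} [CommSemiring L] {n : ℕ}
    (G : Matrix σ (Fin n) L) : Submodule L (MvPolynomial σ L) :=
  (homogeneousSubmodule σ L 2) ⊓
    ⨅ j : Fin n, LinearMap.ker (aeval fun i => G i j).toLinearMap

lemma MvPolynomial.homogeneousSubmodule_two_eq_span (σ R : Type*) [CommSemiring R] :
    homogeneousSubmodule σ R 2 =
      Submodule.span R {f | ∃ i j : σ, f = X i * X j} := by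
  rw [← homogeneousSubmodule_one_pow, pow_two, homogeneousSubmodule_one_eq_span_X,
    Submodule.span_mul_span]
  congr 1
  ext f
  simp [Set.mem_mul, eq_comm]

/-- A submodule containing the adjacent minors contains all binomials `X i * X j - X k * X l`
of equal weight. -/
lemma X_mul_X_sub_mem_of_add_eq {R : Type*} [CommRing R] {r : ℕ}
    {M : Submodule R (MvPolynomial (Fin r) R)}
    (hM : ∀ i i' j j' : Fin r, (i' : ℕ) = i + 1 → (j' : ℕ) = j + 1 →
      (X i * X j' - X i' * X j : MvPolynomial (Fin r) R) ∈ M)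
    {i j k l : Fin r} (h : (i : ℕ) + j = k + l) :
    (X i * X j - X k * X l : MvPolynomial (Fin r) R) ∈ M := by
  have shift : ∀ (t : ℕ) (i j k l : Fin r), (k : ℕ) = i + t → (j : ℕ) = l + t →
      (X i * X j - X k * X l : MvPolynomial (Fin r) R) ∈ M := by
    intro t
    induction t with
    | zero =>
      intro i j k l hk hj
      obtain rfl : k = i := Fin.ext hk
      obtain rfl : j = l := Fin.ext hj
      simp
    | succ t ih =>
      intro i j k l hk hj
      let i' : Fin r := ⟨i + 1, by omega⟩
      let j' : Fin r := ⟨j - 1, by omega⟩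
      have h₁ := hM i i' j' j rfl (by simp only [j']; omega)
      have h₂ := ih i' j' k l (by simp only [i']; omega) (by simp only [j']; omega)
      simpa using M.add_mem h₁ h₂
  rcases le_total (i : ℕ) k with hik | hki
  · exact shift (k - i) i j k l (by omega) (by omega)
  · have := M.neg_mem (shift (i - k) k l i j (by omega) (by omega))
    rwa [neg_sub] at this

/-- Modulo the adjacent minors, a quadratic form is determined by its restriction to the
rational normal curve. -/
lemma mem_of_aeval_X_pow_eq_zero {R : Type*} [CommRing R] {r : ℕ}
    {M : Submodule R (MvPolynomial (Fin r) R)}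
    (hM : ∀ i i' j j' : Fin r, (i' : ℕ) = i + 1 → (j' : ℕ) = j + 1 →
      (X i * X j' - X i' * X j : MvPolynomial (Fin r) R) ∈ M)
    {f : MvPolynomial (Fin r) R} (hf : f ∈ homogeneousSubmodule (Fin r) R 2)
    (h0 : aeval (fun i : Fin r => (Polynomial.X ^ (i : ℕ) : Polynomial R)) f = 0) :
    f ∈ M := by
  classical
  let N : ℕ → MvPolynomial (Fin r) R := fun s =>
    if h : ∃ p : Fin r × Fin r, (p.1 : ℕ) + p.2 = s then X h.choose.1 * X h.choose.2 else 0
  have hN (i j : Fin r) : X i * X j - N (i + j) ∈ M := by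
    have h : ∃ p : Fin r × Fin r, (p.1 : ℕ) + p.2 = i + j := ⟨(i, j), rfl⟩
    simp only [N, dif_pos h]
    exact X_mul_X_sub_mem_of_add_eq hM h.choose_spec.symm
  let φ : Polynomial R →ₗ[R] MvPolynomial (Fin r) R :=
    (Polynomial.basisMonomials R).constr R N
  have hφ (s : ℕ) : φ (Polynomial.X ^ s) = N s := by
    rw [← Polynomial.monomial_one_right_eq_X_pow]
    simpa only [Polynomial.coe_basisMonomials] using
      (Polynomial.basisMonomials R).constr_basis R N s
  have key : f - φ (aeval (fun i : Fin r => (Polynomial.X ^ (i : ℕ) : Polynomial R)) f) ∈ M := by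
    clear h0
    rw [homogeneousSubmodule_two_eq_span] at hf
    induction hf using Submodule.span_induction with
    | mem f hf =>
      obtain ⟨i, j, rfl⟩ := hf
      simpa [← pow_add, hφ] using hN i j
    | zero => simp
    | add f g _ _ hf hg =>
      rw [map_add, map_add, add_sub_add_comm]
      exact M.add_mem hf hg
    | smul c f _ hf =>
      rw [map_smul, map_smul, ← smul_sub]
      exact M.smul_mem c hf
  simpa [h0] using key

lemma aeval_X_pow_mem_degreeLT {R : Type*} [CommRing R] {r : ℕ}
    {f : MvPolynomial (Fin r) R} (hf : f ∈ homogeneousSubmodule (Fin r) R 2) :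
    aeval (fun i : Fin r => (Polynomial.X ^ (i : ℕ) : Polynomial R)) f ∈
      Polynomial.degreeLT R (2 * r - 1) := by
  rw [homogeneousSubmodule_two_eq_span] at hf
  induction hf using Submodule.span_induction with
  | mem f hf =>
    obtain ⟨i, j, rfl⟩ := hf
    simp only [map_mul, aeval_X, ← pow_add, Polynomial.mem_degreeLT]
    exact (Polynomial.degree_X_pow_le _).trans_lt (by exact_mod_cast (by omega))
  | zero => simp
  | add f g _ _ hf hg =>
    rw [map_add]
    exact Submodule.add_mem _ hf hg
  | smul c f _ hf =>
    rw [map_smul]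
    exact Submodule.smul_mem _ c hf

lemma aeval_pow_mul_eq_sq_mul_eval {R : Type*} [CommRing R] {r : ℕ} (a b : R)
    {f : MvPolynomial (Fin r) R} (hf : f ∈ homogeneousSubmodule (Fin r) R 2) :
    aeval (fun i : Fin r => a ^ (i : ℕ) * b) f = b ^ 2 *
      (aeval (fun i : Fin r => (Polynomial.X ^ (i : ℕ) : Polynomial R)) f).eval a := by
  rw [homogeneousSubmodule_two_eq_span] at hf
  induction hf using Submodule.span_induction with
  | mem f hf =>
    obtain ⟨i, j, rfl⟩ := hf
    simp only [map_mul, aeval_X, Polynomial.eval_mul, Polynomial.eval_pow, Polynomial.eval_X]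
    ring
  | zero => simp
  | add f g _ _ hf hg => rw [map_add, map_add, hf, hg, Polynomial.eval_add, mul_add]
  | smul c f _ hf =>
    rw [map_smul, map_smul, hf, Polynomial.eval_smul, smul_eq_mul, smul_eq_mul, mul_left_comm]

theorem stmt3 {F : Type*} [Field F] {n : ℕ} (r : ℕ) (x y : Fin n → F)
    (hx : Function.Injective x) (hy : ∀ i, y i ≠ 0)
    (hr : 2 ≤ r) (hn : 2 * r - 1 ≤ n) :
    I2 (Matrix.of fun (i : Fin r) (j : Fin n) => x j ^ (i : ℕ) * y j) =
      Submodule.span F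
        { f : MvPolynomial (Fin r) F |
          ∃ (i j : ℕ) (hi : i + 1 < r) (hj : j + 1 < r), i < j ∧
            f = X (⟨i, Nat.lt_of_succ_lt hi⟩ : Fin r) * X (⟨j + 1, hj⟩ : Fin r)
              - X (⟨i + 1, hi⟩ : Fin r) * X (⟨j, Nat.lt_of_succ_lt hj⟩ : Fin r) } := by
  apply le_antisymm
  · rintro f ⟨hf, hker⟩
    refine mem_of_aeval_X_pow_eq_zero ?_ hf ?_
    · intro i i' j j' hi hj
      obtain ⟨i, hi₀⟩ := i
      obtain ⟨i', hi₁⟩ := i'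
      obtain ⟨j, hj₀⟩ := j
      obtain ⟨j', hj₁⟩ := j'
      simp only at hi hj
      subst hi hj
      rcases lt_trichotomy i j with h | rfl | h
      · exact Submodule.subset_span ⟨i, j, hi₁, hj₁, h, rfl⟩
      · rw [mul_comm, sub_self]
        exact Submodule.zero_mem _
      · rw [← neg_sub]
        refine Submodule.neg_mem _ (Submodule.subset_span ⟨j, i, hj₁, hi₁, h, ?_⟩)
        ring
    · refine Polynomial.eq_zero_of_degree_lt_of_eval_index_eq_zero Finset.univ
        hx.injOn ?_ fun j _ => ?_
      · rw [Finset.card_univ, Fintype.card_fin]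
        exact (Polynomial.mem_degreeLT.mp (aeval_X_pow_mem_degreeLT hf)).trans_le
          (by exact_mod_cast hn)
      · have h : aeval (fun i : Fin r => x j ^ (i : ℕ) * y j) f = 0 :=
          (Submodule.mem_iInf _).mp hker j
        rw [aeval_pow_mul_eq_sq_mul_eval _ _ hf] at h
        exact (mul_eq_zero.mp h).resolve_left (pow_ne_zero 2 (hy j))
  · rw [Submodule.span_le]
    rintro _ ⟨i, j, hi, hj, -, rfl⟩
    refine ⟨Submodule.sub_mem _ ?_ ?_, (Submodule.mem_iInf _).mpr fun k => ?_⟩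
    · exact (isHomogeneous_X F _).mul (isHomogeneous_X F _)
    · exact (isHomogeneous_X F _).mul (isHomogeneous_X F _)
    · simp only [LinearMap.mem_ker, AlgHom.toLinearMap_apply, map_sub, map_mul, aeval_X,
        Matrix.of_apply]
      ring
end
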